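/- For each n, let Σ_n and Σ̂_n be random symmetric positive definite k×k real matrices, let Λ ⊆ {λ ∈ ℝ^k : λᵀ1 = 1} be nonempty, let λ̂_n ∈ Λ minimize λᵀΣ̂_nλ over Λ and λ*_n ∈ Λ minimize λᵀΣ_nλ over Λ (assume such minimizers exist). If ‖I − Σ̂_nΣ_n⁻¹‖_op → 0 in probability as n → ∞, then λ̂_nᵀΣ_nλ̂_n / λ*_nᵀΣ_nλ*_n → 1 in probability, i.e. the constrained average estimator's quadratic risk is asymptotically equivalent to the constrained oracle risk. -/

import Mathlib

open MeasureTheory Filter Matrix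

/-- The operator norm of a `k × k` real matrix, induced by the Euclidean norm
on `ℝ^k`: `‖M‖_op = sup_{‖x‖ = 1} ‖M x‖`. -/
noncomputable def opNorm {k : ℕ} (M : Matrix (Fin k) (Fin k) ℝ) : ℝ :=
  ‖LinearMap.toContinuousLinearMap (Matrix.toEuclideanLin M)‖

open scoped MatrixOrder in
/-- If `T` is symmetric and all real eigenvalues of `T * S⁻¹` are nonnegative, with `S` positive
definite, then `T` is positive semidefinite. -/
theorem Matrix.IsHermitian.posSemidef_of_mul_inv_eigenvalue_nonneg {k : ℕ}
    {S T : Matrix (Fin k) (Fin k) ℝ} (hT : T.IsHermitian) (hS : S.PosDef)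
    (h : ∀ (ν : ℝ) (w : Fin k → ℝ), w ≠ 0 → (T * S⁻¹) *ᵥ w = ν • w → 0 ≤ ν) :
    T.PosSemidef := by
  obtain ⟨B, hB⟩ := CStarAlgebra.nonneg_iff_eq_star_mul_self.mp hS.posSemidef.nonneg
  rw [Matrix.star_eq_conjTranspose] at hB
  have hdet : IsUnit B.det := by
    have h1 : S.det ≠ 0 := hS.det_pos.ne'
    rw [hB, Matrix.det_mul] at h1
    exact isUnit_iff_ne_zero.mpr (right_ne_zero_of_mul h1)
  have hdet' : IsUnit Bᴴ.det := by
    rw [Matrix.det_conjTranspose]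
    exact hdet.star
  have hA : (B⁻¹ᴴ * T * B⁻¹).IsHermitian := Matrix.isHermitian_conjTranspose_mul_mul B⁻¹ hT
  have hpsd : (B⁻¹ᴴ * T * B⁻¹).PosSemidef := by
    rw [hA.posSemidef_iff_eigenvalues_nonneg]
    intro i
    have hv := hA.mulVec_eigenvectorBasis i
    set v : Fin k → ℝ := ⇑(hA.eigenvectorBasis i)
    have hv0 : v ≠ 0 := by
      intro h0
      apply (hA.eigenvectorBasis.orthonormal.ne_zero i)
      ext j
      exact congrFun h0 j
    refine h _ (Bᴴ *ᵥ v) ?_ ?_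
    · intro h0
      apply hv0
      have : Bᴴ⁻¹ *ᵥ (Bᴴ *ᵥ v) = 0 := by rw [h0, Matrix.mulVec_zero]
      rwa [Matrix.mulVec_mulVec, Matrix.nonsing_inv_mul _ hdet', Matrix.one_mulVec] at this
    · rw [← Matrix.mulVec_smul, ← hv, Matrix.mulVec_mulVec, Matrix.mulVec_mulVec, hB,
        Matrix.mul_inv_rev, Matrix.conjTranspose_nonsing_inv]
      congr 1
      simp only [Matrix.mul_assoc]
      rw [Matrix.nonsing_inv_mul _ hdet', Matrix.mul_nonsing_inv_cancel_left _ _ hdet',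
        Matrix.mul_one]
  have hTB : T = Bᴴ * (B⁻¹ᴴ * T * B⁻¹) * B := by
    rw [Matrix.conjTranspose_nonsing_inv]
    simp only [Matrix.mul_assoc]
    rw [Matrix.nonsing_inv_mul _ hdet, Matrix.mul_nonsing_inv_cancel_left _ _ hdet',
      Matrix.mul_one]
  rw [hTB]
  exact hpsd.conjTranspose_mul_mul_same B

theorem abs_le_opNorm_of_mulVec_eq_smul {k : ℕ} {M : Matrix (Fin k) (Fin k) ℝ} {c : ℝ}
    {w : Fin k → ℝ} (hw : w ≠ 0) (h : M *ᵥ w = c • w) : |c| ≤ opNorm M := by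
  have h1 := (LinearMap.toContinuousLinearMap (Matrix.toEuclideanLin M)).le_opNorm
    (WithLp.toLp 2 w)
  have h2 : LinearMap.toContinuousLinearMap (Matrix.toEuclideanLin M) (WithLp.toLp 2 w) =
      c • WithLp.toLp 2 w := by
    ext i
    simpa using congrFun h i
  rw [h2, norm_smul, Real.norm_eq_abs] at h1
  have h3 : 0 < ‖WithLp.toLp 2 w‖ := by
    rw [norm_pos_iff]
    simpa using hw
  exact le_of_mul_le_mul_right h1 h3

/-- The quadratic forms of `S` and `Shat` differ by at most a relative error
`‖1 - Shat * S⁻¹‖_op`. -/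
theorem abs_dotProduct_mulVec_sub_le {k : ℕ} {S Shat : Matrix (Fin k) (Fin k) ℝ}
    (hS : S.PosDef) (hShat : Shat.IsHermitian) (x : Fin k → ℝ) :
    |x ⬝ᵥ (S *ᵥ x) - x ⬝ᵥ (Shat *ᵥ x)| ≤ opNorm (1 - Shat * S⁻¹) * (x ⬝ᵥ (S *ᵥ x)) := by
  set δ := opNorm (1 - Shat * S⁻¹)
  have hdet : IsUnit S.det := isUnit_iff_ne_zero.mpr hS.det_pos.ne'
  have hδS : (δ • S).IsHermitian := by
    rw [Matrix.IsHermitian, Matrix.conjTranspose_smul, hS.isHermitian.eq, star_trivial]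
  have hD : (S - Shat).IsHermitian := hS.isHermitian.sub hShat
  have hDS : (S - Shat) * S⁻¹ = 1 - Shat * S⁻¹ := by
    rw [Matrix.sub_mul, Matrix.mul_nonsing_inv _ hdet]
  have hupper : (δ • S - (S - Shat)).PosSemidef := by
    refine (hδS.sub hD).posSemidef_of_mul_inv_eigenvalue_nonneg hS fun ν w hw h => ?_
    rw [Matrix.sub_mul, Matrix.smul_mul, Matrix.mul_nonsing_inv _ hdet, hDS,
      Matrix.sub_mulVec, Matrix.smul_mulVec, Matrix.one_mulVec] at h
    have : (1 - Shat * S⁻¹) *ᵥ w = (δ - ν) • w := by rw [sub_smul, ← h]; abel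
    linarith [le_abs_self (δ - ν), abs_le_opNorm_of_mulVec_eq_smul hw this]
  have hlower : (δ • S + (S - Shat)).PosSemidef := by
    refine (hδS.add hD).posSemidef_of_mul_inv_eigenvalue_nonneg hS fun ν w hw h => ?_
    rw [Matrix.add_mul, Matrix.smul_mul, Matrix.mul_nonsing_inv _ hdet, hDS,
      Matrix.add_mulVec, Matrix.smul_mulVec, Matrix.one_mulVec] at h
    have : (1 - Shat * S⁻¹) *ᵥ w = (ν - δ) • w := by rw [sub_smul, ← h]; abel
    linarith [neg_abs_le (ν - δ), abs_le_opNorm_of_mulVec_eq_smul hw this]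
  have h1 := hupper.dotProduct_mulVec_nonneg x
  have h2 := hlower.dotProduct_mulVec_nonneg x
  simp only [star_trivial, Matrix.sub_mulVec, Matrix.add_mulVec, Matrix.smul_mulVec,
    dotProduct_sub, dotProduct_add, dotProduct_smul, smul_eq_mul] at h1 h2
  rw [abs_le]
  constructor <;> linarith

theorem abs_div_sub_one_le {a b δ : ℝ} (hb : 0 < b) (hba : b ≤ a) (hδ : δ ≤ 1 / 2)
    (h : (1 - δ) * a ≤ (1 + δ) * b) : |a / b - 1| ≤ 4 * δ := by
  have hab : 1 ≤ a / b := (one_le_div hb).mpr hba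
  rw [abs_of_nonneg (by linarith), sub_le_iff_le_add, div_le_iff₀ hb]
  nlinarith

/-- If `‖I - Σ̂ₙ Σₙ⁻¹‖_op → 0` in probability, then the quadratic risk of the
constrained average estimator is asymptotically equivalent to that of the
constrained oracle: `λ̂ₙᵀ Σₙ λ̂ₙ / λ*ₙᵀ Σₙ λ*ₙ → 1` in probability. -/
theorem constrained_oracle_equivalence (k : ℕ)
    {Ω : Type*} [MeasurableSpace Ω] (μ : Measure Ω) [IsProbabilityMeasure μ]
    (S Shat : ℕ → Ω → Matrix (Fin k) (Fin k) ℝ)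
    (hS : ∀ n ω, (S n ω).PosDef) (hShat : ∀ n ω, (Shat n ω).PosDef)
    (Λ : Set (Fin k → ℝ)) (hΛ : Λ.Nonempty)
    (hΛsub : Λ ⊆ {lam : Fin k → ℝ | lam ⬝ᵥ (1 : Fin k → ℝ) = 1})
    (lamhat lamstar : ℕ → Ω → Fin k → ℝ)
    (hhat_mem : ∀ n ω, lamhat n ω ∈ Λ)
    (hhat_min : ∀ n ω, ∀ lam ∈ Λ,
      lamhat n ω ⬝ᵥ (Shat n ω *ᵥ lamhat n ω) ≤ lam ⬝ᵥ (Shat n ω *ᵥ lam))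
    (hstar_mem : ∀ n ω, lamstar n ω ∈ Λ)
    (hstar_min : ∀ n ω, ∀ lam ∈ Λ,
      lamstar n ω ⬝ᵥ (S n ω *ᵥ lamstar n ω) ≤ lam ⬝ᵥ (S n ω *ᵥ lam))
    (hconv : TendstoInMeasure μ (fun n ω => opNorm (1 - Shat n ω * (S n ω)⁻¹))
      atTop (fun _ => (0 : ℝ))) :
    TendstoInMeasure μ
      (fun n ω => (lamhat n ω ⬝ᵥ (S n ω *ᵥ lamhat n ω)) /
        (lamstar n ω ⬝ᵥ (S n ω *ᵥ lamstar n ω)))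
      atTop (fun _ => (1 : ℝ)) := by
  have hrisk : ∀ n ω, opNorm (1 - Shat n ω * (S n ω)⁻¹) ≤ 1 / 2 →
      |(lamhat n ω ⬝ᵥ (S n ω *ᵥ lamhat n ω)) / (lamstar n ω ⬝ᵥ (S n ω *ᵥ lamstar n ω)) - 1| ≤
        4 * opNorm (1 - Shat n ω * (S n ω)⁻¹) := by
    intro n ω hδ
    have hne : lamstar n ω ≠ 0 := by
      intro h0
      have h1 : lamstar n ω ⬝ᵥ (1 : Fin k → ℝ) = 1 := hΛsub (hstar_mem n ω)
      rw [h0, zero_dotProduct] at h1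
      exact zero_ne_one h1
    have hpos : 0 < lamstar n ω ⬝ᵥ (S n ω *ᵥ lamstar n ω) := by
      simpa using (hS n ω).dotProduct_mulVec_pos hne
    refine abs_div_sub_one_le hpos (hstar_min n ω _ (hhat_mem n ω)) hδ ?_
    have h1 := abs_le.mp
      (abs_dotProduct_mulVec_sub_le (hS n ω) (hShat n ω).isHermitian (lamhat n ω))
    have h2 := abs_le.mp
      (abs_dotProduct_mulVec_sub_le (hS n ω) (hShat n ω).isHermitian (lamstar n ω))
    linarith [h1.2, h2.1, hhat_min n ω _ (hstar_mem n ω)]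
  rw [tendstoInMeasure_iff_norm] at hconv ⊢
  intro ε hε
  have hη : 0 < min (ε / 4) (1 / 2) := by positivity
  refine tendsto_of_tendsto_of_tendsto_of_le_of_le tendsto_const_nhds (hconv _ hη)
    (fun _ => zero_le) fun n => measure_mono fun ω hω => ?_
  simp only [Set.mem_ofPred_eq, sub_zero, Real.norm_eq_abs] at hω ⊢
  by_contra! hlt
  have hlt' := (le_abs_self _).trans_lt hlt
  have h1 := hlt'.trans_le (min_le_left _ _)
  have h2 := hlt'.trans_le (min_le_right _ _)
  linarith [hrisk n ω h2.le]
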